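/- Under Assumptions (A1)–(A6), the random variables ∫_{√N(Θ−T_N)} | e^{ω_N(t)} π(T_N + t/√N) − e^{−½ tᵀ V* t} π(θ*) | dt converge to 0 in P-probability as N → ∞. -/

import Mathlib

open MeasureTheory Filter Matrix

attribute [local instance] Matrix.frobeniusNormedAddCommGroup

theorem integrable_exp_neg_mul_norm_sq_pi {d : ℕ} {c : ℝ} (hc : 0 < c) :
    Integrable fun t : Fin d → ℝ => Real.exp (-(c * ‖t‖ ^ 2)) := by
  have hb : 0 < c / (d + 1) := by positivity
  have hprod : Integrable (fun t : Fin d → ℝ => ∏ i, Real.exp (-(c / (d + 1)) * t i ^ 2)) :=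
    Integrable.fintype_prod (f := fun _ x => Real.exp (-(c / (d + 1)) * x ^ 2))
      (fun _ => integrable_exp_neg_mul_sq hb)
  refine hprod.mono' (by fun_prop) (Eventually.of_forall fun t => ?_)
  rw [Real.norm_eq_abs, Real.abs_exp, ← Real.exp_sum, Real.exp_le_exp, ← Finset.mul_sum]
  have hsum : ∑ i, t i ^ 2 ≤ (d + 1) * ‖t‖ ^ 2 := by
    calc ∑ i, t i ^ 2 ≤ ∑ _i : Fin d, ‖t‖ ^ 2 := Finset.sum_le_sum fun i _ => by
          have := norm_le_pi_norm t i
          rw [Real.norm_eq_abs] at this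
          rw [← sq_abs]
          gcongr
      _ = d * ‖t‖ ^ 2 := by simp
      _ ≤ _ := by gcongr; linarith
  have := mul_le_mul_of_nonneg_left hsum hb.le
  have h2 : c / (d + 1) * ((d + 1) * ‖t‖ ^ 2) = c * ‖t‖ ^ 2 := by field_simp
  linarith

theorem abs_apply_le_frobenius_norm {d : ℕ} (A : Matrix (Fin d) (Fin d) ℝ) (i j : Fin d) :
    |A i j| ≤ ‖A‖ := by
  rw [Matrix.frobenius_norm_def, ← Real.sqrt_eq_rpow]
  refine Real.le_sqrt_of_sq_le ?_
  have h1 : ‖A i j‖ ^ (2 : ℝ) ≤ ∑ j, ‖A i j‖ ^ (2 : ℝ) :=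
    Finset.single_le_sum (f := fun j => ‖A i j‖ ^ (2 : ℝ)) (fun _ _ => by positivity)
      (Finset.mem_univ j)
  have h2 : ∑ j, ‖A i j‖ ^ (2 : ℝ) ≤ ∑ i, ∑ j, ‖A i j‖ ^ (2 : ℝ) :=
    Finset.single_le_sum (f := fun i => ∑ j, ‖A i j‖ ^ (2 : ℝ)) (fun _ _ => by positivity)
      (Finset.mem_univ i)
  simpa using h1.trans h2

theorem abs_dotProduct_le {d : ℕ} (x y : Fin d → ℝ) : |x ⬝ᵥ y| ≤ d * (‖x‖ * ‖y‖) := by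
  calc |x ⬝ᵥ y| ≤ ∑ i, |x i * y i| := Finset.abs_sum_le_sum_abs _ _
    _ ≤ ∑ _i : Fin d, ‖x‖ * ‖y‖ := Finset.sum_le_sum fun i _ => by
        rw [abs_mul]
        exact mul_le_mul (norm_le_pi_norm x i) (norm_le_pi_norm y i) (abs_nonneg _) (norm_nonneg _)
    _ = _ := by simp

theorem norm_mulVec_le_frobenius {d : ℕ} (A : Matrix (Fin d) (Fin d) ℝ) (y : Fin d → ℝ) :
    ‖A *ᵥ y‖ ≤ d * (‖A‖ * ‖y‖) := by
  refine (pi_norm_le_iff_of_nonneg (by positivity)).2 fun i => ?_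
  calc |∑ j, A i j * y j| ≤ ∑ j, |A i j * y j| := Finset.abs_sum_le_sum_abs _ _
    _ ≤ ∑ _j : Fin d, ‖A‖ * ‖y‖ := Finset.sum_le_sum fun j _ => by
        rw [abs_mul]
        exact mul_le_mul (abs_apply_le_frobenius_norm A i j) (norm_le_pi_norm y j) (abs_nonneg _)
          (norm_nonneg _)
    _ = _ := by simp

theorem abs_dotProduct_mulVec_self_le {d : ℕ} (A : Matrix (Fin d) (Fin d) ℝ) (x : Fin d → ℝ) :
    |x ⬝ᵥ A *ᵥ x| ≤ d ^ 2 * ‖A‖ * ‖x‖ ^ 2 := by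
  calc |x ⬝ᵥ A *ᵥ x| ≤ d * (‖x‖ * ‖A *ᵥ x‖) := abs_dotProduct_le _ _
    _ ≤ d * (‖x‖ * (d * (‖A‖ * ‖x‖))) := by gcongr; exact norm_mulVec_le_frobenius A x
    _ = _ := by ring

theorem Matrix.PosDef.exists_pos_mul_norm_sq_le {d : ℕ} {A : Matrix (Fin d) (Fin d) ℝ}
    (hA : A.PosDef) : ∃ c > 0, ∀ x : Fin d → ℝ, c * ‖x‖ ^ 2 ≤ x ⬝ᵥ A *ᵥ x := by
  have hcont : Continuous fun x : Fin d → ℝ => x ⬝ᵥ A *ᵥ x := by fun_prop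
  rcases (Metric.sphere (0 : Fin d → ℝ) 1).eq_empty_or_nonempty with hS | hS
  · refine ⟨1, one_pos, fun x => ?_⟩
    have hx : x = 0 := by
      by_contra hx
      have : ‖x‖⁻¹ • x ∈ Metric.sphere (0 : Fin d → ℝ) 1 := by
        simp [norm_smul, norm_ne_zero_iff.2 hx]
      simp [hS] at this
    simp [hx]
  · obtain ⟨z, hz, hmin⟩ := (isCompact_sphere (0 : Fin d → ℝ) 1).exists_isMinOn hS
      hcont.continuousOn
    have hz0 : z ≠ 0 := by rintro rfl; simp at hz
    refine ⟨z ⬝ᵥ A *ᵥ z, by simpa using hA.dotProduct_mulVec_pos hz0, fun x => ?_⟩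
    rcases eq_or_ne x 0 with rfl | hx
    · simp
    have hx' : 0 < ‖x‖ := norm_pos_iff.2 hx
    have hmem : ‖x‖⁻¹ • x ∈ Metric.sphere (0 : Fin d → ℝ) 1 := by
      simp [norm_smul, hx'.ne']
    have h := hmin hmem
    simp only [Set.mem_ofPred_eq, mulVec_smul, smul_dotProduct, dotProduct_smul, smul_eq_mul] at h
    calc _ ≤ (‖x‖⁻¹ * (‖x‖⁻¹ * x ⬝ᵥ A *ᵥ x)) * ‖x‖ ^ 2 := by gcongr
      _ = _ := by field_simp

theorem integral_comp_add_inv_smul {d : ℕ} (f : (Fin d → ℝ) → ℝ) (a b : Fin d → ℝ) {r : ℝ}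
    (hr : 0 < r) :
    ∫ t, f (a + r⁻¹ • (t + b)) = r ^ d * ∫ x, f x := by
  rw [integral_add_right_eq_self (fun t => f (a + r⁻¹ • t)) b,
    Measure.integral_comp_inv_smul volume (fun t => f (a + t)) r, integral_add_left_eq_self]
  simp [abs_of_pos hr]

theorem MeasureTheory.Integrable.comp_add_inv_smul {d : ℕ} {f : (Fin d → ℝ) → ℝ}
    (hf : Integrable f) (a b : Fin d → ℝ) {r : ℝ} (hr : 0 < r) :
    Integrable fun t => f (a + r⁻¹ • (t + b)) := by
  have h := ((hf.comp_add_left a).comp_smul (inv_ne_zero hr.ne')).comp_add_right b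
  exact h

/-- Dominated convergence for local posterior densities. The local parameter is
`t = r (θ - θs) - g`, `W` is the recentred log-likelihood and `Q` its limiting quadratic form. -/
theorem tendsto_setIntegral_abs_local_density {d : ℕ} {ι : Type*} {L : Filter ι}
    [L.IsCountablyGenerated] {Θ : Set (Fin d → ℝ)} (hΘ : MeasurableSet Θ)
    {r : ι → ℝ} (hr : Tendsto r L atTop)
    {θs g : ι → Fin d → ℝ} {θlim : Fin d → ℝ} (hθs : Tendsto θs L (nhds θlim))
    (hθlim : Θ ∈ nhds θlim) {B : ℝ} (hg : ∀ᶠ i in L, ‖g i‖ ≤ B)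
    {W : ι → (Fin d → ℝ) → ℝ} (hW : ∀ i, Measurable (W i))
    {Q : (Fin d → ℝ) → ℝ} (hQ : Continuous Q)
    {c C δ : ℝ} (hc : 0 < c) (hδ : 0 < δ) (hQc : ∀ t, c * ‖t‖ ^ 2 ≤ Q t)
    (hnear : ∀ᶠ i in L, ∀ t, θs i + (r i)⁻¹ • (t + g i) ∈ Θ →
      ‖(r i)⁻¹ • (t + g i)‖ ≤ δ → W i t ≤ C - c * ‖t‖ ^ 2)
    (hlim : ∀ t, Tendsto (fun i => W i t) L (nhds (-Q t)))
    (hfar : ∀ η > 0, ∃ ε > 0, ∀ᶠ i in L, ∀ t, θs i + (r i)⁻¹ • (t + g i) ∈ Θ →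
      η ≤ ‖(r i)⁻¹ • (t + g i)‖ → W i t ≤ -(ε * r i ^ 2))
    {π : (Fin d → ℝ) → ℝ} (hπ0 : ∀ θ, 0 ≤ π θ) (hπm : Measurable π) (hπi : Integrable π)
    (hπc : ContinuousAt π θlim) :
    Tendsto (fun i => ∫ t in {t | θs i + (r i)⁻¹ • (t + g i) ∈ Θ},
      |Real.exp (W i t) * π (θs i + (r i)⁻¹ • (t + g i)) - Real.exp (-Q t) * π θlim|)
      L (nhds 0) := by
  have hr0 : Tendsto (fun i => (r i)⁻¹) L (nhds 0) := tendsto_inv_atTop_zero.comp hr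
  have hshift : ∀ t, Tendsto (fun i => (r i)⁻¹ • (t + g i)) L (nhds 0) := fun t => by
    refine hr0.zero_smul_isBoundedUnder_le (isBoundedUnder_of_eventually_le (a := ‖t‖ + B) ?_)
    filter_upwards [hg] with i hi
    exact (norm_add_le _ _).trans (by gcongr)
  have hpt : ∀ t, Tendsto (fun i => θs i + (r i)⁻¹ • (t + g i)) L (nhds θlim) := fun t => by
    simpa using hθs.add (hshift t)
  have hmap : ∀ i, Measurable fun t => θs i + (r i)⁻¹ • (t + g i) := fun i => by fun_prop
  obtain ⟨ρ, hρ, hπρ⟩ := Metric.eventually_nhds_iff.1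
    (hπc.eventually (gt_mem_nhds (show π θlim < π θlim + 1 by linarith)))
  set η := min δ (ρ / 2) with hη
  have hη0 : 0 < η := by positivity
  obtain ⟨ε, hε, hfarε⟩ := hfar η hη0
  set S : ι → Set (Fin d → ℝ) := fun i => {t | θs i + (r i)⁻¹ • (t + g i) ∈ Θ} with hS
  set U : ι → Set (Fin d → ℝ) := fun i => {t | ‖(r i)⁻¹ • (t + g i)‖ < η} with hU
  have hSm : ∀ i, MeasurableSet (S i) := fun i => hmap i hΘ
  have hUm : ∀ i, MeasurableSet (U i) := fun i =>
    measurableSet_lt (by fun_prop) measurable_const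
  set F : ι → (Fin d → ℝ) → ℝ := fun i t =>
    |Real.exp (W i t) * π (θs i + (r i)⁻¹ • (t + g i)) - Real.exp (-Q t) * π θlim| with hF
  have hFm : ∀ i, Measurable (F i) := fun i => by
    have h1 := hπm.comp (hmap i)
    have h2 := (hW i).exp
    have h3 : Measurable fun t => Real.exp (-Q t) * π θlim := by fun_prop
    exact ((h2.mul h1).sub h3).abs
  set H : ι → (Fin d → ℝ) → ℝ := fun i t =>
    (S i ∩ U i).indicator (F i) t + (U i)ᶜ.indicator (fun t => Real.exp (-Q t) * π θlim) t with hH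
  set bound : (Fin d → ℝ) → ℝ := fun t =>
    (Real.exp C * (π θlim + 1) + π θlim) * Real.exp (-(c * ‖t‖ ^ 2)) with hbd
  have hbound : Integrable bound := (integrable_exp_neg_mul_norm_sq_pi hc).const_mul _
  have hHm : ∀ i, Measurable (H i) := fun i =>
    ((hFm i).indicator ((hSm i).inter (hUm i))).add
      (Measurable.indicator (by fun_prop) (hUm i).compl)
  have hQb : ∀ t, Real.exp (-Q t) * π θlim ≤ π θlim * Real.exp (-(c * ‖t‖ ^ 2)) := fun t => by
    rw [mul_comm]
    exact mul_le_mul_of_nonneg_left (Real.exp_le_exp.2 (neg_le_neg (hQc t))) (hπ0 _)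
  have hQ0 : ∀ t, 0 ≤ Real.exp (-Q t) * π θlim := fun t => mul_nonneg (Real.exp_pos _).le (hπ0 _)
  have hHb : ∀ᶠ i in L, ∀ t, ‖H i t‖ ≤ bound t := by
    filter_upwards [hnear, Metric.tendsto_nhds.1 hθs (ρ / 2) (by positivity)] with i hi hθi t
    by_cases htU : t ∈ U i
    · have h2 : (U i)ᶜ.indicator (fun t => Real.exp (-Q t) * π θlim) t = 0 := by simp [htU]
      by_cases htS : t ∈ S i
      · have h1 : (S i ∩ U i).indicator (F i) t = F i t :=
          Set.indicator_of_mem (Set.mem_inter htS htU) _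
        have hUt : ‖(r i)⁻¹ • (t + g i)‖ < η := htU
        have hWt := hi t htS (hUt.le.trans (min_le_left _ _))
        have hπt : π (θs i + (r i)⁻¹ • (t + g i)) < π θlim + 1 := by
          refine hπρ ?_
          rw [dist_eq_norm] at hθi ⊢
          have : θs i + (r i)⁻¹ • (t + g i) - θlim = (θs i - θlim) + (r i)⁻¹ • (t + g i) := by abel
          rw [this]
          have := norm_add_le (θs i - θlim) ((r i)⁻¹ • (t + g i))
          have := min_le_right δ (ρ / 2)
          linarith
        have hE : Real.exp (W i t) * π (θs i + (r i)⁻¹ • (t + g i)) ≤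
            Real.exp C * (π θlim + 1) * Real.exp (-(c * ‖t‖ ^ 2)) := by
          calc _ ≤ Real.exp (C - c * ‖t‖ ^ 2) * (π θlim + 1) :=
                mul_le_mul (Real.exp_le_exp.2 hWt) hπt.le (hπ0 _) (Real.exp_pos _).le
            _ = _ := by rw [sub_eq_add_neg, Real.exp_add]; ring
        have hE0 : 0 ≤ Real.exp (W i t) * π (θs i + (r i)⁻¹ • (t + g i)) :=
          mul_nonneg (Real.exp_pos _).le (hπ0 _)
        simp only [hH, h1, h2, add_zero, hbd]
        simp only [hF, Real.norm_eq_abs, abs_abs]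
        rw [abs_le]
        have := hQb t
        have := hQ0 t
        constructor <;> nlinarith
      · have h1 : (S i ∩ U i).indicator (F i) t = 0 :=
          Set.indicator_of_notMem (fun h => htS h.1) _
        simp only [hH, h1, h2, add_zero, norm_zero, hbd]
        have := hπ0 θlim
        positivity
    · have h1 : (S i ∩ U i).indicator (F i) t = 0 :=
        Set.indicator_of_notMem (fun h => htU h.2) _
      have h2 : (U i)ᶜ.indicator (fun t => Real.exp (-Q t) * π θlim) t
          = Real.exp (-Q t) * π θlim := by simp [htU]
      simp only [hH, h1, h2, zero_add, Real.norm_eq_abs, abs_of_nonneg (hQ0 t), hbd]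
      refine (hQb t).trans ?_
      have := hπ0 θlim
      gcongr
      have : 0 ≤ Real.exp C * (π θlim + 1) := by positivity
      linarith
  have hHlim : ∀ t, Tendsto (fun i => H i t) L (nhds 0) := fun t => by
    have hFt : Tendsto (fun i => F i t) L (nhds 0) := by
      have h1 : Tendsto (fun i => π (θs i + (r i)⁻¹ • (t + g i))) L (nhds (π θlim)) :=
        hπc.tendsto.comp (hpt t)
      have h2 := (((Real.continuous_exp.tendsto _).comp (hlim t)).mul h1).sub_const
        (Real.exp (-Q t) * π θlim)
      rw [sub_self] at h2
      have h3 := h2.abs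
      rw [abs_zero] at h3
      exact h3
    refine hFt.congr' ?_
    have hUt : ∀ᶠ i in L, t ∈ U i := by
      have := (hshift t).norm
      rw [norm_zero] at this
      exact this.eventually (gt_mem_nhds hη0)
    filter_upwards [hUt, (hpt t).eventually hθlim] with i h1 h2
    have h3 : (S i ∩ U i).indicator (F i) t = F i t := 
      Set.indicator_of_mem (Set.mem_inter (show t ∈ S i from h2) h1) _
    simp [hH, h3, h1]
  have hHint : Tendsto (fun i => ∫ t, H i t) L (nhds 0) := by
    simpa using tendsto_integral_filter_of_dominated_convergence bound
      (Eventually.of_forall fun i => (hHm i).aestronglyMeasurable)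
      (hHb.mono fun i hi => Eventually.of_forall hi) hbound
      (Eventually.of_forall hHlim)
  have htail : Tendsto (fun i => Real.exp (-(ε * r i ^ 2)) * (r i ^ d * ∫ x, π x)) L (nhds 0) := by
    have h1 : Tendsto (fun x : ℝ => (ε⁻¹ ^ d * ∫ x, π x) * (x ^ d * Real.exp (-x))) atTop
        (nhds 0) := by
      simpa using (Real.tendsto_pow_mul_exp_neg_atTop_nhds_zero d).const_mul (ε⁻¹ ^ d * ∫ x, π x)
    have h2 : Tendsto (fun i => ε * r i ^ 2) L atTop :=
      ((tendsto_pow_atTop two_ne_zero).comp hr).const_mul_atTop hε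
    refine squeeze_zero' ?_ ?_ (h1.comp h2)
    · filter_upwards [hr.eventually_ge_atTop 1] with i hi
      have : 0 ≤ ∫ x, π x := integral_nonneg fun x => hπ0 x
      positivity
    · filter_upwards [hr.eventually_ge_atTop 1] with i hi
      have : 0 ≤ ∫ x, π x := integral_nonneg fun x => hπ0 x
      have h3 : r i ^ d ≤ (r i ^ 2) ^ d := by gcongr; nlinarith
      calc Real.exp (-(ε * r i ^ 2)) * (r i ^ d * ∫ x, π x)
          ≤ Real.exp (-(ε * r i ^ 2)) * ((r i ^ 2) ^ d * ∫ x, π x) := by gcongr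
        _ = _ := by simp only [Function.comp_apply, mul_pow, inv_pow]; field_simp
  refine squeeze_zero' (Eventually.of_forall fun i => integral_nonneg fun t => abs_nonneg _) ?_
    (by simpa using hHint.add htail)
  filter_upwards [hfarε, hHb, hr.eventually_ge_atTop 1] with i hi hHi hri
  have hri0 : 0 < r i := by linarith
  rw [← integral_indicator (hSm i)]
  have hHI : Integrable (H i) :=
    hbound.mono' (hHm i).aestronglyMeasurable (Eventually.of_forall hHi)
  have hπI := (hπi.comp_add_inv_smul (θs i) (g i) hri0).const_mul (Real.exp (-(ε * r i ^ 2)))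
  rw [← integral_comp_add_inv_smul π (θs i) (g i) hri0, ← integral_const_mul,
    ← integral_add hHI hπI]
  refine integral_mono_of_nonneg
    (Eventually.of_forall fun t => Set.indicator_nonneg (fun _ _ => abs_nonneg _) _)
    (hHI.add hπI) (Eventually.of_forall fun t => ?_)
  have hT0 : 0 ≤ Real.exp (-(ε * r i ^ 2)) * π (θs i + (r i)⁻¹ • (t + g i)) :=
    mul_nonneg (Real.exp_pos _).le (hπ0 _)
  by_cases htU : t ∈ U i
  · have h2 : (U i)ᶜ.indicator (fun t => Real.exp (-Q t) * π θlim) t = 0 := by simp [htU]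
    have h1 : (S i ∩ U i).indicator (F i) t = (S i).indicator (F i) t := by
      by_cases htS : t ∈ S i <;> simp [Set.indicator, htU, htS, Set.mem_inter_iff]
    simp only [hH, h1, h2, add_zero]
    linarith
  · have h1 : (S i ∩ U i).indicator (F i) t = 0 :=
      Set.indicator_of_notMem (fun h => htU h.2) _
    have h2 : (U i)ᶜ.indicator (fun t => Real.exp (-Q t) * π θlim) t
        = Real.exp (-Q t) * π θlim := by simp [htU]
    simp only [hH, h1, h2, zero_add]
    by_cases htS : t ∈ S i
    · rw [Set.indicator_of_mem htS]
      change |Real.exp (W i t) * π (θs i + (r i)⁻¹ • (t + g i)) - Real.exp (-Q t) * π θlim| ≤ _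
      have hWt := hi t htS (not_lt.1 htU)
      have hE : Real.exp (W i t) * π (θs i + (r i)⁻¹ • (t + g i)) ≤
          Real.exp (-(ε * r i ^ 2)) * π (θs i + (r i)⁻¹ • (t + g i)) :=
        mul_le_mul_of_nonneg_right (Real.exp_le_exp.2 hWt) (hπ0 _)
      have hE0 : 0 ≤ Real.exp (W i t) * π (θs i + (r i)⁻¹ • (t + g i)) :=
        mul_nonneg (Real.exp_pos _).le (hπ0 _)
      have := hQ0 t
      rw [abs_le]
      constructor <;> linarith
    · rw [Set.indicator_of_notMem htS]
      exact add_nonneg (hQ0 t) hT0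

theorem complete_square_of_mulVec_eq {d : ℕ} {V R : Matrix (Fin d) (Fin d) ℝ} (hV : V.IsSymm)
    (t g : Fin d → ℝ) {r : ℝ} (hr : r ≠ 0) :
    (r • V *ᵥ g) ⬝ᵥ (r⁻¹ • (t + g)) -
        1 / 2 * ((r⁻¹ • (t + g)) ⬝ᵥ (r ^ 2 • V + R) *ᵥ (r⁻¹ • (t + g))) -
        1 / 2 * (g ⬝ᵥ V *ᵥ g) =
      -(1 / 2) * (t ⬝ᵥ V *ᵥ t) - 1 / 2 * ((r ^ 2)⁻¹ * ((t + g) ⬝ᵥ R *ᵥ (t + g))) := by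
  have hsymm : g ⬝ᵥ V *ᵥ t = t ⬝ᵥ V *ᵥ g := by
    rw [dotProduct_mulVec, ← hV.eq, vecMul_transpose, hV.eq, dotProduct_comm]
  have h1 : (V *ᵥ g) ⬝ᵥ t = t ⬝ᵥ V *ᵥ g := dotProduct_comm _ _
  have h2 : (V *ᵥ g) ⬝ᵥ g = g ⬝ᵥ V *ᵥ g := dotProduct_comm _ _
  simp only [smul_dotProduct, dotProduct_smul, mulVec_smul, add_mulVec, smul_mulVec, smul_eq_mul,
    dotProduct_add, add_dotProduct, mulVec_add, h1, h2, hsymm]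
  field_simp
  ring

/-- Bernstein–von Mises convergence along an arbitrary countably generated filter, for
deterministic data. -/
theorem tendsto_setIntegral_abs_posterior_sub_gaussian {d : ℕ} {ι : Type*} {L : Filter ι}
    [L.IsCountablyGenerated] {Θ : Set (Fin d → ℝ)} (hΘ : MeasurableSet Θ)
    {n : ι → ℕ} (hn : Tendsto n L atTop)
    {ℓ : ι → (Fin d → ℝ) → ℝ} (hℓ : ∀ i, ContinuousOn (ℓ i) Θ)
    {θs G : ι → Fin d → ℝ} {V : ι → Matrix (Fin d) (Fin d) ℝ}
    (hVsymm : ∀ i, (V i).IsSymm) (hVunit : ∀ i, IsUnit (V i).det)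
    {R : ι → (Fin d → ℝ) → Matrix (Fin d) (Fin d) ℝ}
    (hexpand : ∀ i, ∀ θ ∈ Θ, ℓ i θ = ℓ i (θs i) + G i ⬝ᵥ (θ - θs i) -
      (1 / 2) * ((θ - θs i) ⬝ᵥ ((n i : ℝ) • V i + R i θ).mulVec (θ - θs i)))
    {π : (Fin d → ℝ) → ℝ} (hπ0 : ∀ θ, 0 ≤ π θ) (hπm : Measurable π) (hπi : Integrable π)
    {θlim : Fin d → ℝ} (hθlim : Θ ∈ nhds θlim) (hθs : Tendsto θs L (nhds θlim))
    {Vlim : Matrix (Fin d) (Fin d) ℝ} (hVlim : Vlim.PosDef) (hV : Tendsto V L (nhds Vlim))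
    {M : ℝ} (hG : ∀ᶠ i in L, ‖G i‖ ≤ M * Real.sqrt (n i))
    (hfar : ∀ δ > 0, ∃ ε > 0, ∀ᶠ i in L, ∀ θ ∈ Θ, δ ≤ ‖θ - θs i‖ →
      ℓ i θ - ℓ i (θs i) ≤ -(ε * n i))
    (hR : ∀ ε > 0, ∃ δ > 0, ∀ᶠ i in L, ∀ θ ∈ Θ, ‖θ - θs i‖ ≤ δ → ‖R i θ‖ ≤ ε * n i)
    (hπc : ContinuousAt π θlim) :
    Tendsto (fun i => ∫ t in {t : Fin d → ℝ |
        (θs i + (n i : ℝ)⁻¹ • (V i)⁻¹.mulVec (G i)) + (Real.sqrt (n i))⁻¹ • t ∈ Θ},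
      |Real.exp (ℓ i ((θs i + (n i : ℝ)⁻¹ • (V i)⁻¹.mulVec (G i)) + (Real.sqrt (n i))⁻¹ • t) -
            ℓ i (θs i) - (2 * (n i : ℝ))⁻¹ * (G i ⬝ᵥ (V i)⁻¹.mulVec (G i))) *
          π ((θs i + (n i : ℝ)⁻¹ • (V i)⁻¹.mulVec (G i)) + (Real.sqrt (n i))⁻¹ • t) -
        Real.exp (-(1 / 2) * (t ⬝ᵥ Vlim.mulVec t)) * π θlim|) L (nhds 0) := by
  classical
  set r : ι → ℝ := fun i => Real.sqrt (n i) with hrdef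
  set g : ι → Fin d → ℝ := fun i => (r i)⁻¹ • (V i)⁻¹ *ᵥ G i with hgdef
  have hr : Tendsto r L atTop :=
    Real.tendsto_sqrt_atTop.comp (tendsto_natCast_atTop_atTop.comp hn)
  have hr2 : ∀ i, (n i : ℝ) = r i ^ 2 := fun i => (Real.sq_sqrt (Nat.cast_nonneg _)).symm
  have hcenter : ∀ i t, (θs i + (n i : ℝ)⁻¹ • (V i)⁻¹ *ᵥ G i) + (Real.sqrt (n i))⁻¹ • t =
      θs i + (r i)⁻¹ • (t + g i) := fun i t => by
    change (θs i + (n i : ℝ)⁻¹ • (V i)⁻¹ *ᵥ G i) + (r i)⁻¹ • t = _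
    rw [hr2, hgdef, smul_add, smul_smul, ← mul_inv, ← sq]
    abel
  have hVinvG : ∀ᶠ i in L, (V i)⁻¹ *ᵥ G i = r i • g i := by
    filter_upwards [hr.eventually_gt_atTop 0] with i hi
    simp [hgdef, smul_smul, hi.ne']
  have hGg : ∀ᶠ i in L, G i = r i • V i *ᵥ g i := by
    filter_upwards [hVinvG] with i hi
    rw [← mulVec_smul, ← hi, mulVec_mulVec, mul_nonsing_inv _ (hVunit i), one_mulVec]
  obtain ⟨c, hc, hcV⟩ := hVlim.exists_pos_mul_norm_sq_le
  have hVsub : Tendsto (fun i => (d : ℝ) ^ 2 * ‖V i - Vlim‖) L (nhds 0) := by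
    simpa using (tendsto_iff_norm_sub_tendsto_zero.1 hV).const_mul ((d : ℝ) ^ 2)
  have hVdiff : ∀ i t, |t ⬝ᵥ V i *ᵥ t - t ⬝ᵥ Vlim *ᵥ t| ≤ (d : ℝ) ^ 2 * ‖V i - Vlim‖ * ‖t‖ ^ 2 :=
    fun i t => by
      rw [← dotProduct_sub, ← sub_mulVec]
      exact abs_dotProduct_mulVec_self_le _ _
  have hVpos : ∀ᶠ i in L, ∀ t, c / 2 * ‖t‖ ^ 2 ≤ t ⬝ᵥ V i *ᵥ t := by
    filter_upwards [hVsub.eventually (gt_mem_nhds (half_pos hc))] with i hi t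
    have h1 := (abs_le.1 (hVdiff i t)).1
    have h2 := hcV t
    have h3 := mul_le_mul_of_nonneg_right hi.le (sq_nonneg ‖t‖)
    linarith
  set B : ℝ := 2 * d * |M| / c with hB
  have hB0 : 0 ≤ B := by positivity
  have hg : ∀ᶠ i in L, ‖g i‖ ≤ B := by
    filter_upwards [hVpos, hGg, hG, hr.eventually_gt_atTop 0] with i h1 h2 h3 h4
    have h5 : g i ⬝ᵥ V i *ᵥ g i ≤ d * (‖g i‖ * |M|) := by
      refine (le_abs_self _).trans ((abs_dotProduct_le _ _).trans ?_)
      have h6 : ‖V i *ᵥ g i‖ ≤ |M| := by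
        rw [h2, norm_smul, Real.norm_eq_abs, abs_of_pos h4, mul_comm] at h3
        exact (le_of_mul_le_mul_right h3 h4).trans (le_abs_self _)
      gcongr
    have h6 := (h1 (g i)).trans h5
    rcases (norm_nonneg (g i)).eq_or_lt with h7 | h7
    · rw [← h7]; exact hB0
    · rw [hB, le_div_iff₀ hc]
      nlinarith
  set W : ι → (Fin d → ℝ) → ℝ := fun i t =>
    Θ.piecewise (ℓ i) 0 (θs i + (r i)⁻¹ • (t + g i)) - ℓ i (θs i) -
      (2 * (n i : ℝ))⁻¹ * (G i ⬝ᵥ (V i)⁻¹ *ᵥ G i) with hW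
  have hWm : ∀ i, Measurable (W i) := fun i => by
    have h1 : Measurable (Θ.piecewise (ℓ i) 0) :=
      (hℓ i).measurable_piecewise continuousOn_const hΘ
    have h2 : Measurable fun t => θs i + (r i)⁻¹ • (t + g i) := by fun_prop
    exact ((h1.comp h2).sub_const _).sub_const _
  have hquad : ∀ᶠ i in L, (2 * (n i : ℝ))⁻¹ * (G i ⬝ᵥ (V i)⁻¹ *ᵥ G i) =
      1 / 2 * (g i ⬝ᵥ V i *ᵥ g i) := by
    filter_upwards [hVinvG, hGg, hr.eventually_gt_atTop 0] with i h1 h2 h3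
    rw [h1, hr2]
    nth_rw 1 [h2]
    rw [smul_dotProduct, dotProduct_smul, dotProduct_comm (V i *ᵥ g i), smul_eq_mul, smul_eq_mul]
    field_simp
  have hWeq : ∀ᶠ i in L, ∀ t, θs i + (r i)⁻¹ • (t + g i) ∈ Θ → W i t =
      -(1 / 2) * (t ⬝ᵥ V i *ᵥ t) - 1 / 2 * ((r i ^ 2)⁻¹ *
        ((t + g i) ⬝ᵥ R i (θs i + (r i)⁻¹ • (t + g i)) *ᵥ (t + g i))) := by
    filter_upwards [hquad, hGg, hr.eventually_gt_atTop 0] with i h1 h2 h3 t ht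
    rw [← complete_square_of_mulVec_eq (hVsymm i) t (g i) h3.ne', ← h2]
    simp only [hW, Set.piecewise_eq_of_mem _ _ _ ht, h1]
    rw [hexpand i _ ht, add_sub_cancel_left, hr2]
    ring
  have hrem : ∀ ε > 0, ∃ δ > 0, ∀ᶠ i in L, ∀ t, θs i + (r i)⁻¹ • (t + g i) ∈ Θ →
      ‖(r i)⁻¹ • (t + g i)‖ ≤ δ → |W i t + 1 / 2 * (t ⬝ᵥ V i *ᵥ t)| ≤
        ε * (‖t‖ ^ 2 + B ^ 2) := fun ε hε => by
    obtain ⟨δ, hδ, h⟩ := hR (ε / ((d : ℝ) ^ 2 + 1)) (by positivity)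
    refine ⟨δ, hδ, ?_⟩
    filter_upwards [h, hWeq, hg, hr.eventually_gt_atTop 0] with i h1 h2 h3 h4 t ht htδ
    have hR' := h1 _ ht (by simpa using htδ)
    rw [h2 t ht]
    set A := R i (θs i + (r i)⁻¹ • (t + g i))
    have h5 : ‖t + g i‖ ^ 2 ≤ 2 * (‖t‖ ^ 2 + B ^ 2) := by
      have h6 : ‖t + g i‖ ≤ ‖t‖ + B := (norm_add_le _ _).trans (by gcongr)
      have h7 : ‖t + g i‖ ^ 2 ≤ (‖t‖ + B) ^ 2 := by gcongr
      nlinarith [sq_nonneg (‖t‖ - B)]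
    have h8 : |(t + g i) ⬝ᵥ A *ᵥ (t + g i)| ≤ ε * r i ^ 2 * (2 * (‖t‖ ^ 2 + B ^ 2)) := by
      calc _ ≤ (d : ℝ) ^ 2 * ‖A‖ * ‖t + g i‖ ^ 2 := abs_dotProduct_mulVec_self_le _ _
        _ ≤ ((d : ℝ) ^ 2 + 1) * (ε / ((d : ℝ) ^ 2 + 1) * n i) * (2 * (‖t‖ ^ 2 + B ^ 2)) := by
            gcongr
            linarith
        _ = _ := by rw [hr2]; field_simp
    have h9 : -(1 / 2) * (t ⬝ᵥ V i *ᵥ t) - 1 / 2 * ((r i ^ 2)⁻¹ * ((t + g i) ⬝ᵥ A *ᵥ (t + g i))) +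
        1 / 2 * (t ⬝ᵥ V i *ᵥ t) = -(1 / 2 * (r i ^ 2)⁻¹) * ((t + g i) ⬝ᵥ A *ᵥ (t + g i)) := by ring
    rw [h9, abs_mul, abs_neg, abs_of_pos (show 0 < 1 / 2 * (r i ^ 2)⁻¹ by positivity)]
    calc _ ≤ 1 / 2 * (r i ^ 2)⁻¹ * (ε * r i ^ 2 * (2 * (‖t‖ ^ 2 + B ^ 2))) := by gcongr
      _ = _ := by field_simp
  have hshift : ∀ t, Tendsto (fun i => (r i)⁻¹ • (t + g i)) L (nhds 0) := fun t => by
    refine (tendsto_inv_atTop_zero.comp hr).zero_smul_isBoundedUnder_le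
      (isBoundedUnder_of_eventually_le (a := ‖t‖ + B) ?_)
    filter_upwards [hg] with i hi
    exact (norm_add_le _ _).trans (by gcongr)
  obtain ⟨δ, hδ, hremδ⟩ := hrem (c / 8) (by positivity)
  have key := tendsto_setIntegral_abs_local_density (L := L) hΘ hr hθs hθlim hg hWm
    (Q := fun t => 1 / 2 * (t ⬝ᵥ Vlim *ᵥ t)) (by fun_prop) (c := c / 8) (C := c / 8 * B ^ 2)
    (by positivity) hδ (fun t => by have := hcV t; nlinarith [sq_nonneg ‖t‖]) ?_ ?_ ?_
    hπ0 hπm hπi hπc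
  · refine key.congr fun i => ?_
    simp only [hcenter]
    refine setIntegral_congr_fun ?_ fun t ht => ?_
    · exact (show Measurable fun t => θs i + (r i)⁻¹ • (t + g i) by fun_prop) hΘ
    · have ht' : θs i + (r i)⁻¹ • (t + g i) ∈ Θ := ht
      simp only [hW, Set.piecewise_eq_of_mem _ _ _ ht', neg_mul]
  · filter_upwards [hremδ, hVpos] with i h1 h2 t ht htδ
    have := (abs_le.1 (h1 t ht htδ)).2
    have := h2 t
    linarith
  · intro t
    have hmem : ∀ᶠ i in L, θs i + (r i)⁻¹ • (t + g i) ∈ Θ :=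
      (show Tendsto (fun i => θs i + (r i)⁻¹ • (t + g i)) L (nhds θlim) by
        simpa only [add_zero] using hθs.add (hshift t)).eventually hθlim
    have hmain : Tendsto (fun i => t ⬝ᵥ V i *ᵥ t) L (nhds (t ⬝ᵥ Vlim *ᵥ t)) := by
      rw [tendsto_iff_norm_sub_tendsto_zero]
      refine squeeze_zero (fun _ => norm_nonneg _) (fun i => hVdiff i t) ?_
      simpa using hVsub.mul_const (‖t‖ ^ 2)
    have hrem0 : Tendsto (fun i => W i t + 1 / 2 * (t ⬝ᵥ V i *ᵥ t)) L (nhds 0) := by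
      rw [Metric.tendsto_nhds]
      intro ε hε
      have hK : 0 < ‖t‖ ^ 2 + B ^ 2 + 1 := by positivity
      obtain ⟨δ', hδ', h⟩ := hrem (ε / (‖t‖ ^ 2 + B ^ 2 + 1)) (by positivity)
      have hsmall : ∀ᶠ i in L, ‖(r i)⁻¹ • (t + g i)‖ < δ' := by
        have := (hshift t).norm
        rw [norm_zero] at this
        exact this.eventually (gt_mem_nhds hδ')
      filter_upwards [h, hmem, hsmall] with i h1 h2 h3
      rw [dist_zero_right, Real.norm_eq_abs]
      refine (h1 t h2 h3.le).trans_lt ?_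
      rw [div_mul_eq_mul_div, div_lt_iff₀ hK]
      nlinarith
    have h := hrem0.sub (hmain.const_mul (1 / 2))
    simp only [add_sub_cancel_right, zero_sub] at h
    exact h
  · intro η hη
    obtain ⟨ε, hε, h⟩ := hfar η hη
    refine ⟨ε, hε, ?_⟩
    filter_upwards [h, hquad, hVpos] with i h1 h2 h3 t ht htη
    have h4 := h1 _ ht (by simpa using htη)
    have h5 : 0 ≤ g i ⬝ᵥ V i *ᵥ g i := le_trans (by positivity) (h3 (g i))
    simp only [hW, Set.piecewise_eq_of_mem _ _ _ ht, h2]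
    rw [hr2] at h4
    linarith

/-- The filter on `ℕ × Ω` of the sets `S` such that the probability of leaving `S` inside the
events `D N` tends to zero. -/
def probFilter {Ω : Type*} [MeasurableSpace Ω] (P : Measure Ω) (D : ℕ → Set Ω) :
    Filter (ℕ × Ω) where
  sets := {S | Tendsto (fun N => P {ω | (N, ω) ∉ S ∧ ω ∈ D N}) atTop (nhds 0)}
  univ_sets := by simp
  sets_of_superset {S T} hS hST :=
    tendsto_of_tendsto_of_tendsto_of_le_of_le tendsto_const_nhds hS (fun _ => zero_le)
      fun _ => measure_mono fun _ h => ⟨fun h' => h.1 (hST h'), h.2⟩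
  inter_sets {S T} hS hT := by
    have hST := Tendsto.add hS hT
    rw [add_zero] at hST
    refine tendsto_of_tendsto_of_tendsto_of_le_of_le tendsto_const_nhds hST
      (fun _ => zero_le) fun N => (measure_mono fun ω h => ?_).trans (measure_union_le _ _)
    by_cases hωS : (N, ω) ∈ S
    · exact Or.inr ⟨fun hωT => h.1 ⟨hωS, hωT⟩, h.2⟩
    · exact Or.inl ⟨hωS, h.2⟩

theorem mem_probFilter {Ω : Type*} [MeasurableSpace Ω] {P : Measure Ω} {D : ℕ → Set Ω}
    {S : Set (ℕ × Ω)} :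
    S ∈ probFilter P D ↔ Tendsto (fun N => P {ω | (N, ω) ∉ S ∧ ω ∈ D N}) atTop (nhds 0) :=
  Iff.rfl

theorem tendsto_fst_probFilter {Ω : Type*} [MeasurableSpace Ω] {P : Measure Ω}
    {D : ℕ → Set Ω} : Tendsto Prod.fst (probFilter P D) atTop := by
  refine tendsto_atTop.2 fun m => mem_probFilter.2 (tendsto_const_nhds.congr' ?_)
  filter_upwards [eventually_ge_atTop m] with N hN
  simp [hN]

theorem mem_probFilter_of_subset {Ω : Type*} [MeasurableSpace Ω] {P : Measure Ω}
    {D A : ℕ → Set Ω} {S : Set (ℕ × Ω)} (hA : Tendsto (fun N => P (A N)) atTop (nhds 0))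
    (h : ∀ N, ∀ ω ∈ D N, ω ∉ A N → (N, ω) ∈ S) : S ∈ probFilter P D := by
  refine mem_probFilter.2 (tendsto_of_tendsto_of_tendsto_of_le_of_le tendsto_const_nhds hA
    (fun _ => zero_le) fun N => measure_mono fun ω hω => ?_)
  by_contra hωA
  exact hω.1 (h N ω hω.2 hωA)

theorem measurableSet_forall_mem_le {Ω E : Type*} [MeasurableSpace Ω] [TopologicalSpace E]
    [SecondCountableTopology E] {f : Ω → E → ℝ} {S : Set E} (hf : ∀ x, Measurable fun ω => f ω x)
    (hc : ∀ ω, ContinuousOn (f ω) S) (b : ℝ) : MeasurableSet {ω | ∀ x ∈ S, f ω x ≤ b} := by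
  obtain ⟨s, hs, hsd⟩ := TopologicalSpace.exists_countable_dense S
  have h : {ω | ∀ x ∈ S, f ω x ≤ b} = ⋂ x ∈ s, {ω | f ω x ≤ b} := by
    ext ω
    simp only [Set.mem_iInter]
    refine ⟨fun h x _ => h x x.2, fun h x hx => ?_⟩
    have hcl : IsClosed {y : S | f ω y ≤ b} :=
      isClosed_le (continuousOn_iff_continuous_domRestrict.1 (hc ω)) continuous_const
    exact (hcl.closure_subset_iff.2 (fun y hy => h y hy)) (hsd ⟨x, hx⟩)
  rw [h]
  exact MeasurableSet.biInter hs fun x _ => measurableSet_le (hf x) measurable_const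

/-- Under Assumptions (A1)–(A6) of the misspecified Bernstein–von Mises setup,
the random variables `∫_{√N(Θ−T_N)} | e^{ω_N(t)} π(T_N + t/√N) − e^{−½ tᵀ V* t} π(θ*) | dt`
converge to `0` in `P`-probability as `N → ∞`, where
`T_N = θ*_N + N⁻¹ V_N⁻¹ G_N` and
`ω_N(t) = ℓ_N(·, T_N + t/√N) − ℓ_N(·, θ*_N) − (2N)⁻¹ G_Nᵀ V_N⁻¹ G_N`. -/
theorem stmt2 {d : ℕ} {Ω : Type*} [MeasurableSpace Ω] (P : Measure Ω) [IsProbabilityMeasure P]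
    (Θ : Set (Fin d → ℝ)) (hΘmeas : MeasurableSet Θ)
    -- misspecified log-likelihoods, measurable in ω, continuous in θ
    (ℓ : ℕ → Ω → (Fin d → ℝ) → ℝ)
    (hℓmeas : ∀ N θ, Measurable fun ω => ℓ N ω θ)
    (hℓcont : ∀ N ω, ContinuousOn (ℓ N ω) Θ)
    -- the points θ*_N, the scores G_N, the matrices V_N and the remainders R_N
    (θs : ℕ → Fin d → ℝ) (hθsΘ : ∀ N, θs N ∈ Θ)
    (G : ℕ → Ω → Fin d → ℝ) (hGmeas : ∀ N, Measurable (G N))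
    (V : ℕ → Matrix (Fin d) (Fin d) ℝ)
    (hVsymm : ∀ N, (V N).IsSymm) (hVunit : ∀ N, IsUnit (V N).det)
    (R : ℕ → Ω → (Fin d → ℝ) → Matrix (Fin d) (Fin d) ℝ)
    (hRsymm : ∀ N ω θ, (R N ω θ).IsSymm)
    (hRmeas : ∀ N θ i j, Measurable fun ω => R N ω θ i j)
    -- the exact second-order expansion of ℓ_N around θ*_N
    (hexpand : ∀ N ω, ∀ θ ∈ Θ,
      ℓ N ω θ = ℓ N ω (θs N) + G N ω ⬝ᵥ (θ - θs N) -
        (1 / 2) * ((θ - θs N) ⬝ᵥ ((N : ℝ) • V N + R N ω θ).mulVec (θ - θs N)))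
    -- the prior density π
    (π : (Fin d → ℝ) → ℝ) (hπnn : ∀ θ, 0 ≤ π θ) (hπmeas : Measurable π)
    (hπdens : ∫ θ, π θ = 1)
    -- (A1)
    (θlim : Fin d → ℝ) (hθlim : θlim ∈ interior Θ)
    (hA1 : Tendsto θs atTop (nhds θlim))
    -- (A2)
    (Vlim : Matrix (Fin d) (Fin d) ℝ) (hVlimSymm : Vlim.IsSymm) (hVlimPD : Vlim.PosDef)
    (hA2 : Tendsto V atTop (nhds Vlim))
    -- (A3): N^{-1/2} G_N is bounded in P-probability
    (hA3 : ∀ η : ℝ, 0 < η → ∃ M : ℝ,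
      limsup (fun N : ℕ => (P {ω | M * Real.sqrt N < ‖G N ω‖}).toReal) atTop < η)
    -- (A4)
    (hA4 : ∀ δ : ℝ, 0 < δ → ∃ ε : ℝ, 0 < ε ∧
      Tendsto (fun N : ℕ => P {ω | ∀ θ ∈ Θ, δ ≤ ‖θ - θs N‖ →
        ℓ N ω θ - ℓ N ω (θs N) ≤ -(ε * N)}) atTop (nhds 1))
    -- (A5)
    (hA5 : ∀ ε : ℝ, 0 < ε → ∃ δ : ℝ, 0 < δ ∧
      Tendsto (fun N : ℕ => P {ω | ∃ θ ∈ Θ, ‖θ - θs N‖ ≤ δ ∧ ε * N ≤ ‖R N ω θ‖})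
        atTop (nhds 0))
    -- (A6)
    (hA6cont : ContinuousAt π θlim) (hA6pos : 0 < π θlim) :
    ∀ ε : ℝ, 0 < ε →
      Tendsto (fun N : ℕ => P {ω | ε <
        ∫ t in {t : Fin d → ℝ |
            (θs N + (N : ℝ)⁻¹ • (V N)⁻¹.mulVec (G N ω)) + (Real.sqrt N)⁻¹ • t ∈ Θ},
          |Real.exp (ℓ N ω ((θs N + (N : ℝ)⁻¹ • (V N)⁻¹.mulVec (G N ω)) +
                (Real.sqrt N)⁻¹ • t) - ℓ N ω (θs N) -
                (2 * (N : ℝ))⁻¹ * (G N ω ⬝ᵥ (V N)⁻¹.mulVec (G N ω))) *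
              π ((θs N + (N : ℝ)⁻¹ • (V N)⁻¹.mulVec (G N ω)) + (Real.sqrt N)⁻¹ • t) -
            Real.exp (-(1 / 2) * (t ⬝ᵥ Vlim.mulVec t)) * π θlim|})
        atTop (nhds 0) := by
  intro ε hε
  have hπi : Integrable π := by
    by_contra h
    rw [integral_undef h] at hπdens
    exact zero_ne_one hπdens
  set X : ℕ × Ω → ℝ := fun p => ∫ t in {t : Fin d → ℝ |
      (θs p.1 + (p.1 : ℝ)⁻¹ • (V p.1)⁻¹.mulVec (G p.1 p.2)) + (Real.sqrt p.1)⁻¹ • t ∈ Θ},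
    |Real.exp (ℓ p.1 p.2 ((θs p.1 + (p.1 : ℝ)⁻¹ • (V p.1)⁻¹.mulVec (G p.1 p.2)) +
          (Real.sqrt p.1)⁻¹ • t) - ℓ p.1 p.2 (θs p.1) -
          (2 * (p.1 : ℝ))⁻¹ * (G p.1 p.2 ⬝ᵥ (V p.1)⁻¹.mulVec (G p.1 p.2))) *
        π ((θs p.1 + (p.1 : ℝ)⁻¹ • (V p.1)⁻¹.mulVec (G p.1 p.2)) + (Real.sqrt p.1)⁻¹ • t) -
      Real.exp (-(1 / 2) * (t ⬝ᵥ Vlim.mulVec t)) * π θlim| with hX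
  change Tendsto (fun N : ℕ => P {ω | ε < X (N, ω)}) atTop (nhds 0)
  have hbounded : ∀ M : ℝ, {p : ℕ × Ω | X p < ε} ∈
      probFilter P fun N => {ω | ‖G N ω‖ ≤ M * Real.sqrt N} := by
    intro M
    have hk : ∀ k : ℕ, (0 : ℝ) < 1 / (k + 1) := fun k => Nat.one_div_pos_of_nat
    choose a ha hA4' using fun k : ℕ => hA4 _ (hk k)
    choose b hb hA5' using fun k : ℕ => hA5 _ (hk k)
    set good : ℕ → Set (ℕ × Ω) := fun k => {p |
      (∀ θ ∈ Θ, 1 / ((k : ℝ) + 1) ≤ ‖θ - θs p.1‖ →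
        ℓ p.1 p.2 θ - ℓ p.1 p.2 (θs p.1) ≤ -(a k * p.1)) ∧
      (∀ θ ∈ Θ, ‖θ - θs p.1‖ ≤ b k → ‖R p.1 p.2 θ‖ ≤ 1 / ((k : ℝ) + 1) * p.1) ∧
      ‖G p.1 p.2‖ ≤ M * Real.sqrt p.1} with hgood
    set L : Filter (ℕ × Ω) := comap Prod.fst atTop ⊓ ⨅ k, Filter.principal (good k) with hL
    have hgoodL : ∀ k, ∀ᶠ p in L, p ∈ good k := fun k =>
      (inf_le_right.trans (iInf_le _ k) : L ≤ Filter.principal (good k)) (mem_principal_self _)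
    have hfst : Tendsto Prod.fst L atTop := tendsto_comap.mono_left inf_le_left
    have hXL : Tendsto X L (nhds 0) := by
      refine tendsto_setIntegral_abs_posterior_sub_gaussian hΘmeas hfst
        (fun p => hℓcont p.1 p.2) (fun p => hVsymm p.1) (fun p => hVunit p.1)
        (R := fun p => R p.1 p.2) (fun p => hexpand p.1 p.2) hπnn hπmeas hπi
        (mem_interior_iff_mem_nhds.1 hθlim) (hA1.comp hfst) hVlimPD (hA2.comp hfst)
        (M := M) ((hgoodL 0).mono fun p hp => hp.2.2) (fun δ hδ => ?_) (fun η hη => ?_) hA6cont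
      · obtain ⟨k, hkδ⟩ := exists_nat_one_div_lt hδ
        exact ⟨a k, ha k, (hgoodL k).mono fun p hp θ hθ h => hp.1 θ hθ (hkδ.le.trans h)⟩
      · obtain ⟨k, hkη⟩ := exists_nat_one_div_lt hη
        refine ⟨b k, hb k, (hgoodL k).mono fun p hp θ hθ h => (hp.2.1 θ hθ h).trans ?_⟩
        gcongr
    have hle : probFilter P (fun N => {ω | ‖G N ω‖ ≤ M * Real.sqrt N}) ≤ L := by
      refine le_inf tendsto_fst_probFilter.le_comap (le_iInf fun k => le_principal_iff.2 ?_)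
      have hmeas : ∀ N, MeasurableSet {ω | ∀ θ ∈ Θ, 1 / ((k : ℝ) + 1) ≤ ‖θ - θs N‖ →
          ℓ N ω θ - ℓ N ω (θs N) ≤ -(a k * N)} := fun N => by
        have h := measurableSet_forall_mem_le (S := Θ ∩ {θ | 1 / ((k : ℝ) + 1) ≤ ‖θ - θs N‖})
          (f := fun ω θ => ℓ N ω θ - ℓ N ω (θs N)) (fun θ => (hℓmeas N θ).sub (hℓmeas N _))
          (fun ω => ((hℓcont N ω).sub continuousOn_const).mono Set.inter_subset_left)
          (-(a k * N))
        convert h using 4 with ω θ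
        exact ⟨fun h hθ => h hθ.1 hθ.2, fun h h1 h2 => h ⟨h1, h2⟩⟩
      have hcompl : Tendsto (fun N : ℕ => P {ω | ∀ θ ∈ Θ, 1 / ((k : ℝ) + 1) ≤ ‖θ - θs N‖ →
          ℓ N ω θ - ℓ N ω (θs N) ≤ -(a k * N)}ᶜ) atTop (nhds 0) := by
        simp_rw [fun N => prob_compl_eq_one_sub (μ := P) (hmeas N)]
        simpa using ENNReal.Tendsto.sub (tendsto_const_nhds (x := (1 : ENNReal))) (hA4' k)
          (Or.inl ENNReal.one_ne_top)
      have h1 := mem_probFilter_of_subset (D := fun N => {ω | ‖G N ω‖ ≤ M * Real.sqrt N})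
        (S := {p | ∀ θ ∈ Θ, 1 / ((k : ℝ) + 1) ≤ ‖θ - θs p.1‖ →
          ℓ p.1 p.2 θ - ℓ p.1 p.2 (θs p.1) ≤ -(a k * p.1)}) hcompl
        fun N ω _ hω => not_not.1 hω
      have h2 := mem_probFilter_of_subset (D := fun N => {ω | ‖G N ω‖ ≤ M * Real.sqrt N})
        (S := {p | ∀ θ ∈ Θ, ‖θ - θs p.1‖ ≤ b k → ‖R p.1 p.2 θ‖ ≤ 1 / ((k : ℝ) + 1) * p.1})
        (hA5' k) fun N ω _ hω θ hθ hθb =>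
          le_of_not_ge fun h => hω ⟨θ, hθ, hθb, h⟩
      have h3 : {p : ℕ × Ω | ‖G p.1 p.2‖ ≤ M * Real.sqrt p.1} ∈
          probFilter P (fun N => {ω | ‖G N ω‖ ≤ M * Real.sqrt N}) :=
        mem_probFilter_of_subset (A := fun _ => ∅) (by simp) fun N ω hω _ => hω
      filter_upwards [h1, h2, h3] with p hp1 hp2 hp3
      exact ⟨hp1, hp2, hp3⟩
    exact hle (hXL.eventually (gt_mem_nhds hε))
  rw [ENNReal.tendsto_nhds_zero]
  intro η hη
  obtain ⟨x, hx0, hxη⟩ := ENNReal.lt_iff_exists_nnreal_btwn.1 (ENNReal.half_pos hη.ne')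
  obtain ⟨M, hM⟩ := hA3 x (by exact_mod_cast hx0)
  have hbdd : IsBoundedUnder (· ≤ ·) atTop
      fun N : ℕ => (P {ω | M * Real.sqrt N < ‖G N ω‖}).toReal :=
    isBoundedUnder_of ⟨1, fun N => measureReal_le_one⟩
  filter_upwards [eventually_lt_of_limsup_lt hM hbdd,
    ENNReal.tendsto_nhds_zero.1 (mem_probFilter.1 (hbounded M)) _ (ENNReal.half_pos hη.ne')]
    with N hN1 hN2
  have hN3 : P {ω | M * Real.sqrt N < ‖G N ω‖} ≤ η / 2 := by
    refine le_trans ?_ hxη.le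
    rw [← ENNReal.ofReal_toReal (measure_ne_top P {ω | M * Real.sqrt N < ‖G N ω‖}),
      ← ENNReal.ofReal_coe_nnreal]
    exact ENNReal.ofReal_le_ofReal hN1.le
  rw [← ENNReal.add_halves η]
  refine (measure_mono fun ω hω => ?_).trans ((measure_union_le _ _).trans (add_le_add hN2 hN3))
  rcases le_or_gt ‖G N ω‖ (M * Real.sqrt N) with h | h
  · exact Or.inl ⟨fun h' => lt_asymm (show ε < X (N, ω) from hω) h', h⟩
  · exact Or.inr h
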